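/- (Each exponential-family member is the maximum-entropy point of its own fiber.) For every θ ∈ ℝ^m and every z ∈ Δ_k^n with A z = A g^{(θ)} (equality of all m coordinates), one has g^{(θ)}·log g^{(θ)} ≤ z·log z; that is, g^{(θ)} minimizes z ↦ z·log z over the set {z ∈ Δ_k^n : A z = A g^{(θ)}}. -/

import Mathlib

open Finset

attribute [local instance] Classical.propDecidable

noncomputable section

/-- The simplex `Δ_k^n`: rows are probability distributions over `Fin k`. -/
def Simplex (n k : ℕ) : Set (Fin n → Fin k → ℝ) :=
  {z | (∀ i ℓ, 0 ≤ z i ℓ) ∧ ∀ i, ∑ ℓ, z i ℓ = 1}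

/-- Number of points where rule `j` does not abstain. -/
def nRule {n k p : ℕ} (h : Fin p → Fin n → Option (Fin k)) (j : Fin p) : ℕ :=
  (Finset.univ.filter (fun i => h j i ≠ none)).card

/-- The constraint matrix `A`, with `m = p + k` rows indexed by `Fin p ⊕ Fin k`. -/
def Amat {n k p : ℕ} (h : Fin p → Fin n → Option (Fin k)) :
    Fin p ⊕ Fin k → Fin n → Fin k → ℝ
  | Sum.inl j => fun i ℓ => if h j i = some ℓ then 1 / (nRule h j : ℝ) else 0
  | Sum.inr ℓ' => fun i ℓ => if ℓ = ℓ' then 1 / (n : ℝ) else 0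

/-- `(A z)_j`. -/
def applyA {n k p : ℕ} (h : Fin p → Fin n → Option (Fin k))
    (z : Fin n → Fin k → ℝ) (j : Fin p ⊕ Fin k) : ℝ :=
  ∑ i, ∑ ℓ, Amat h j i ℓ * z i ℓ

/-- The polytope `P(b, ε)`. -/
def Polytope {n k p : ℕ} (h : Fin p → Fin n → Option (Fin k))
    (b ε : Fin p ⊕ Fin k → ℝ) : Set (Fin n → Fin k → ℝ) :=
  {z | z ∈ Simplex n k ∧ ∀ j, b j - ε j ≤ applyA h z j ∧ applyA h z j ≤ b j + ε j}

/-- Extended-real logarithm, with `elog 0 = ⊥ = -∞`. -/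
def elog (x : ℝ) : EReal := if x = 0 then ⊥ else ((Real.log x : ℝ) : EReal)

/-- `z · log g`, valued in `[-∞, 0]` with the convention `0 · log 0 = 0`. -/
def dotlog {n k : ℕ} (z g : Fin n → Fin k → ℝ) : EReal :=
  ∑ i, ∑ ℓ, (z i ℓ : EReal) * elog (g i ℓ)

/-- `a^{(θ)}_{iℓ} = Σ_j θ_j · A j i ℓ`. -/
def avec {n k p : ℕ} (h : Fin p → Fin n → Option (Fin k))
    (θ : Fin p ⊕ Fin k → ℝ) (i : Fin n) (ℓ : Fin k) : ℝ :=
  ∑ j, θ j * Amat h j i ℓ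

/-- The exponential-family (softmax) prediction `g^{(θ)}`. -/
def gexp {n k p : ℕ} (h : Fin p → Fin n → Option (Fin k))
    (θ : Fin p ⊕ Fin k → ℝ) (i : Fin n) (ℓ : Fin k) : ℝ :=
  Real.exp (avec h θ i ℓ) / ∑ ℓ', Real.exp (avec h θ i ℓ')

/-- The BF dual objective `(σ'−σ)·b − (σ'+σ)·ε − Σ_i log(Σ_ℓ exp(a^{(σ'−σ)}_{iℓ}))`. -/
def dualObj {n k p : ℕ} (h : Fin p → Fin n → Option (Fin k))
    (b ε σ σ' : Fin p ⊕ Fin k → ℝ) : ℝ :=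
  (∑ j, (σ' j - σ j) * b j) - (∑ j, (σ' j + σ j) * ε j)
    - ∑ i, Real.log (∑ ℓ, Real.exp (avec h (fun j => σ' j - σ j) i ℓ))

/-- KL summand `a·log(a/c)`, with `0·log(0/c) = 0` and `a·log(a/0) = ⊤` for `a ≠ 0`. -/
def klTerm (a c : ℝ) : EReal :=
  if a = 0 then 0 else if c = 0 then ⊤ else ((a * Real.log (a / c) : ℝ) : EReal)

/-- `d(μ, ν)`, the summed KL divergences, valued in `[0, +∞]`. -/
def dKL {n k : ℕ} (μ ν : Fin n → Fin k → ℝ) : EReal :=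
  ∑ i, ∑ ℓ, klTerm (μ i ℓ) (ν i ℓ)

/-- Unnormalized one-coin Dawid–Skene score `N_{iℓ}`. -/
def Nds {n k p : ℕ} (h : Fin p → Fin n → Option (Fin k))
    (w : Fin k → ℝ) (β : Fin p → ℝ) (i : Fin n) (ℓ : Fin k) : ℝ :=
  w ℓ * (∏ j ∈ Finset.univ.filter (fun j => h j i = some ℓ), β j)
    * ∏ j ∈ Finset.univ.filter (fun j => ∃ ℓ' ≠ ℓ, h j i = some ℓ'),
        (1 - β j) / ((k : ℝ) - 1)

/-- The one-coin Dawid–Skene prediction `g^{ds}(w, β)`. -/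
def gds {n k p : ℕ} (h : Fin p → Fin n → Option (Fin k))
    (w : Fin k → ℝ) (β : Fin p → ℝ) (i : Fin n) (ℓ : Fin k) : ℝ :=
  Nds h w β i ℓ / ∑ ℓ', Nds h w β i ℓ'

theorem coe_mul_elog_self (x : ℝ) : (x : EReal) * elog x = ((x * Real.log x : ℝ) : EReal) := by
  unfold elog
  split_ifs with hx
  · simp [hx]
  · exact (EReal.coe_mul _ _).symm

theorem coe_finset_sum {ι : Type*} (s : Finset ι) (f : ι → ℝ) :
    ((∑ i ∈ s, f i : ℝ) : EReal) = ∑ i ∈ s, (f i : EReal) :=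
  map_sum (⟨⟨Real.toEReal, EReal.coe_zero⟩, EReal.coe_add⟩ : ℝ →+ EReal) f s

theorem dotlog_self {n k : ℕ} (z : Fin n → Fin k → ℝ) :
    dotlog z z = ((∑ i, ∑ ℓ, z i ℓ * Real.log (z i ℓ) : ℝ) : EReal) := by
  simp only [dotlog, coe_mul_elog_self, coe_finset_sum]

/-- The pointwise inequality behind Gibbs' inequality. -/
theorem mul_log_sub_mul_log_le {x y : ℝ} (hx : 0 ≤ x) (hy : 0 < y) :
    x * Real.log y - x * Real.log x ≤ y - x := by
  rcases hx.eq_or_lt with rfl | hx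
  · simpa using hy.le
  · have hlog := Real.log_le_sub_one_of_pos (div_pos hy hx)
    rw [Real.log_div hy.ne' hx.ne'] at hlog
    calc x * Real.log y - x * Real.log x = x * (Real.log y - Real.log x) := by ring
      _ ≤ x * (y / x - 1) := mul_le_mul_of_nonneg_left hlog hx.le
      _ = y - x := by field_simp

/-- Gibbs' inequality, summed over the rows. -/
theorem sum_mul_log_le_sum_mul_log_self {n k : ℕ} {z g : Fin n → Fin k → ℝ}
    (hz : z ∈ Simplex n k) (hg : g ∈ Simplex n k) (hpos : ∀ i ℓ, 0 < g i ℓ) :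
    ∑ i, ∑ ℓ, z i ℓ * Real.log (g i ℓ) ≤ ∑ i, ∑ ℓ, z i ℓ * Real.log (z i ℓ) := by
  refine Finset.sum_le_sum fun i _ => ?_
  have hle := Finset.sum_le_sum fun ℓ (_ : ℓ ∈ Finset.univ) =>
    mul_log_sub_mul_log_le (hz.1 i ℓ) (hpos i ℓ)
  rw [Finset.sum_sub_distrib, Finset.sum_sub_distrib, hz.2 i, hg.2 i] at hle
  linarith

section ExponentialFamily

variable {n k p : ℕ} (h : Fin p → Fin n → Option (Fin k)) (θ : Fin p ⊕ Fin k → ℝ)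

theorem sum_exp_avec_pos (hk : 0 < k) (i : Fin n) : 0 < ∑ ℓ, Real.exp (avec h θ i ℓ) :=
  Finset.sum_pos (fun _ _ => Real.exp_pos _) ⟨⟨0, hk⟩, Finset.mem_univ _⟩

theorem gexp_pos (hk : 0 < k) (i : Fin n) (ℓ : Fin k) : 0 < gexp h θ i ℓ :=
  div_pos (Real.exp_pos _) (sum_exp_avec_pos h θ hk i)

theorem gexp_mem_simplex (hk : 0 < k) : gexp h θ ∈ Simplex n k := by
  refine ⟨fun i ℓ => (gexp_pos h θ hk i ℓ).le, fun i => ?_⟩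
  simp only [gexp]
  rw [← Finset.sum_div, div_self (sum_exp_avec_pos h θ hk i).ne']

theorem log_gexp (hk : 0 < k) (i : Fin n) (ℓ : Fin k) :
    Real.log (gexp h θ i ℓ) = avec h θ i ℓ - Real.log (∑ ℓ', Real.exp (avec h θ i ℓ')) := by
  rw [gexp, Real.log_div (Real.exp_ne_zero _) (sum_exp_avec_pos h θ hk i).ne', Real.log_exp]

theorem sum_mul_avec (z : Fin n → Fin k → ℝ) :
    ∑ i, ∑ ℓ, z i ℓ * avec h θ i ℓ = ∑ j, θ j * applyA h z j := by
  simp only [avec, applyA, Finset.mul_sum]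
  rw [Finset.sum_comm (s := (Finset.univ : Finset (Fin p ⊕ Fin k)))]
  refine Finset.sum_congr rfl fun i _ => ?_
  rw [Finset.sum_comm]
  exact Finset.sum_congr rfl fun j _ => Finset.sum_congr rfl fun ℓ _ => by ring

/-- On the simplex, `z · log g^{(θ)}` depends on `z` only through `A z`. -/
theorem sum_mul_log_gexp (hk : 0 < k) {z : Fin n → Fin k → ℝ} (hz : z ∈ Simplex n k) :
    ∑ i, ∑ ℓ, z i ℓ * Real.log (gexp h θ i ℓ) =
      ∑ j, θ j * applyA h z j - ∑ i, Real.log (∑ ℓ, Real.exp (avec h θ i ℓ)) := by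
  simp only [log_gexp h θ hk, mul_sub, Finset.sum_sub_distrib, sum_mul_avec, ← Finset.sum_mul,
    hz.2, one_mul]

end ExponentialFamily

/-- each exponential-family member is the maximum-entropy point
of its own fiber. -/
theorem stmt12 {n k p : ℕ} (hn : 0 < n) (hk : 2 ≤ k) (hp : 0 < p)
    (h : Fin p → Fin n → Option (Fin k)) (hnj : ∀ j, 0 < nRule h j)
    (θ : Fin p ⊕ Fin k → ℝ) (z : Fin n → Fin k → ℝ) (hz : z ∈ Simplex n k)
    (hAz : ∀ j, applyA h z j = applyA h (gexp h θ) j) :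
    dotlog (gexp h θ) (gexp h θ) ≤ dotlog z z := by
  have hk₀ : 0 < k := by omega
  have hg := gexp_mem_simplex h θ hk₀
  rw [dotlog_self, dotlog_self, EReal.coe_le_coe_iff]
  calc ∑ i, ∑ ℓ, gexp h θ i ℓ * Real.log (gexp h θ i ℓ)
      = ∑ i, ∑ ℓ, z i ℓ * Real.log (gexp h θ i ℓ) := by
        rw [sum_mul_log_gexp h θ hk₀ hg, sum_mul_log_gexp h θ hk₀ hz]
        simp only [hAz]
    _ ≤ ∑ i, ∑ ℓ, z i ℓ * Real.log (z i ℓ) :=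
        sum_mul_log_le_sum_mul_log_self hz hg (gexp_pos h θ hk₀)
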